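/- Let A ∈ ℂ^{N×(M+N)}, P = diag(p̃) with p̃ ∈ (0,∞)^{M+N}, R = A P A*, and suppose R is invertible. For y ∈ ℂ^N, the minimum over Q ∈ ℂ^{N×(M+N)}... transposed appropriately ... of y* Q* P^{−1} Q y subject to Q* A = I (identity of size N) is attained at Q₀ = P A* R^{−1}, and the minimum value is y* R^{−1} y. -/

import Mathlib

open Matrix

open scoped ComplexOrder

namespace Matrix

variable {m n : Type*} [Fintype m] [DecidableEq m] [Fintype n] [DecidableEq n]

/-- For a positive definite weight `P` and `A * P * Aᴴ` invertible, any right inverse `Q` of `A`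
satisfies a Pythagorean identity with respect to the weighted right inverse
`P * Aᴴ * (A * P * Aᴴ)⁻¹`. -/
theorem conjTranspose_mul_inv_mul_eq_add {P : Matrix n n ℂ} (hP : P.PosDef) {A : Matrix m n ℂ}
    {Q : Matrix n m ℂ} (hdet : IsUnit (A * P * Aᴴ).det) (hQ : A * Q = 1) :
    Qᴴ * P⁻¹ * Q = (A * P * Aᴴ)⁻¹ +
      (Q - P * Aᴴ * (A * P * Aᴴ)⁻¹)ᴴ * P⁻¹ * (Q - P * Aᴴ * (A * P * Aᴴ)⁻¹) := by
  have hPdet : IsUnit P.det := (isUnit_iff_isUnit_det _).mp hP.isUnit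
  have hRH : (A * P * Aᴴ)ᴴ = A * P * Aᴴ := isHermitian_mul_mul_conjTranspose A hP.isHermitian
  have hAQ₀ : A * (P * Aᴴ * (A * P * Aᴴ)⁻¹) = 1 := by
    rw [← Matrix.mul_assoc, ← Matrix.mul_assoc, mul_nonsing_inv _ hdet]
  have hleft : (P * Aᴴ * (A * P * Aᴴ)⁻¹)ᴴ * P⁻¹ = (A * P * Aᴴ)⁻¹ * A := by
    rw [conjTranspose_mul, conjTranspose_mul, conjTranspose_nonsing_inv, hRH,
      conjTranspose_conjTranspose, hP.isHermitian.eq, Matrix.mul_assoc,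
      mul_nonsing_inv_cancel_right _ _ hPdet]
  have hright : Qᴴ * P⁻¹ * (P * Aᴴ * (A * P * Aᴴ)⁻¹) = (A * P * Aᴴ)⁻¹ := by
    rw [Matrix.mul_assoc, Matrix.mul_assoc P, nonsing_inv_mul_cancel_left _ _ hPdet,
      ← Matrix.mul_assoc, ← conjTranspose_mul, hQ, conjTranspose_one, Matrix.one_mul]
  rw [conjTranspose_sub, Matrix.sub_mul, Matrix.sub_mul, Matrix.mul_sub, Matrix.mul_sub,
    hleft, hright, Matrix.mul_assoc _ A, Matrix.mul_assoc _ A, hQ, hAQ₀]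
  simp

end Matrix

/-- The minimum over `Q ∈ ℂ^{(M+N)×N}` of `y* Q* P⁻¹ Q y` subject to the
constraint `Q* A* = I` (equivalently `A Q = I`) is attained at
`Q₀ = P A* R⁻¹` where `R = A P A*`, and the minimum value is `y* R⁻¹ y`. -/
theorem spice_Q_minimization (M N : ℕ) (A : Matrix (Fin N) (Fin (M + N)) ℂ)
    (ptil : Fin (M + N) → ℝ) (hp : ∀ k, 0 < ptil k) (y : Fin N → ℂ)
    (P : Matrix (Fin (M + N)) (Fin (M + N)) ℂ)
    (hP : P = Matrix.diagonal fun k => (ptil k : ℂ))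
    (R : Matrix (Fin N) (Fin N) ℂ) (hR : R = A * P * Aᴴ) (hRinv : IsUnit R.det) :
    letI obj : Matrix (Fin (M + N)) (Fin N) ℂ → ℂ := fun Q =>
      star y ⬝ᵥ (Qᴴ * P⁻¹ * Q).mulVec y
    letI Q₀ : Matrix (Fin (M + N)) (Fin N) ℂ := P * Aᴴ * R⁻¹
    A * Q₀ = 1 ∧
    obj Q₀ = star y ⬝ᵥ R⁻¹.mulVec y ∧
    ∀ Q : Matrix (Fin (M + N)) (Fin N) ℂ, A * Q = 1 →
      (obj Q₀).re ≤ (obj Q).re := by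
  have hPpos : P.PosDef := by
    rw [hP, posDef_diagonal_iff]
    exact fun k => by exact_mod_cast hp k
  subst hR
  have hAQ₀ : A * (P * Aᴴ * (A * P * Aᴴ)⁻¹) = 1 := by
    rw [← Matrix.mul_assoc, ← Matrix.mul_assoc, mul_nonsing_inv _ hRinv]
  have hval : (P * Aᴴ * (A * P * Aᴴ)⁻¹)ᴴ * P⁻¹ * (P * Aᴴ * (A * P * Aᴴ)⁻¹) =
      (A * P * Aᴴ)⁻¹ := by
    simpa using conjTranspose_mul_inv_mul_eq_add hPpos hRinv hAQ₀
  refine ⟨hAQ₀, by beta_reduce; rw [hval], fun Q hQ => ?_⟩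
  beta_reduce
  have hnonneg := (hPpos.inv.posSemidef.conjTranspose_mul_mul_same
    (Q - P * Aᴴ * (A * P * Aᴴ)⁻¹)).re_dotProduct_nonneg y
  rw [hval, conjTranspose_mul_inv_mul_eq_add hPpos hRinv hQ, add_mulVec, dotProduct_add,
    Complex.add_re]
  exact le_add_of_nonneg_right hnonneg
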